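/- For all constants c > 0 and K > 0 there exists N such that for all n = rm ≥ N with integers r ≥ 3, m ≥ 1 and integer d with 1 ≤ d ≤ m^{r−1} − 1 satisfying Λ ≥ c·r^{16}·m^{2−r}: ∫_{𝓑₂} |F(θ)| dθ ≤ e^{−K·r·n·log n} · m^{(r−1)/2} · (2π/(Λ m^{r−1}))^{(n−r+1)/2}, where 𝓑₂ is the set of θ ∈ 𝓑 for which there exists (k₁,…,k_r) ∈ V₁×⋯×V_r with |θ_{k₁} + ⋯ + θ_{k_r}|_{2π} ≥ ρ₀/3 and, for every t ∈ [r], the number of indices j ∈ V_t with |θ_j − θ_{k_t}|_{2π} ≤ ρ₀/(4r) is at least m − m/r. -/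

import Mathlib

open MeasureTheory Filter

/-- The edge density `λ = d / m^(r-1)`. -/
noncomputable def lam (r m d : ℕ) : ℝ := (d : ℝ) / (m : ℝ) ^ (r - 1)

/-- `Λ = λ(1−λ)`. -/
noncomputable def Lam (r m d : ℕ) : ℝ := lam r m d * (1 - lam r m d)

/-- For an edge `e ∈ (Fin m)^r` and `θ ∈ ℝ^n` (vertices indexed by `Fin r × Fin m`,
class `t` being `{t} × Fin m`), the sum `Σ_{j∈e} θ_j`. -/
def edgeSum (r m : ℕ) (θ : Fin r × Fin m → ℝ) (e : Fin r → Fin m) : ℝ :=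
  ∑ t : Fin r, θ (t, e t)

/-- The integrand `F(θ) = (∏_e (1 + λ(e^{iΣ_{j∈e}θ_j} − 1))) · e^{−i d Σ_j θ_j}`. -/
noncomputable def Ffun (r m d : ℕ) (θ : Fin r × Fin m → ℝ) : ℂ :=
  (∏ e : Fin r → Fin m,
      (1 + (lam r m d : ℂ) * (Complex.exp (Complex.I * (edgeSum r m θ e : ℂ)) - 1))) *
    Complex.exp (-Complex.I * (d : ℂ) * ((∑ p : Fin r × Fin m, θ p : ℝ) : ℂ))

/-- Vertex `p` is one of the constrained coordinates `2m, 3m, …, rm`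
(the last vertex of each class except the first). -/
def constrained (r m : ℕ) (p : Fin r × Fin m) : Prop := p.1.val ≠ 0 ∧ p.2.val = m - 1

instance (r m : ℕ) : DecidablePred (constrained r m) :=
  fun p => inferInstanceAs (Decidable (p.1.val ≠ 0 ∧ p.2.val = m - 1))

/-- Extension by zero of a vector of free coordinates to all of `ℝ^n`;
(n−r+1)-dimensional integrals over subsets of `𝓑` are realised by pulling back along it. -/
def ext (r m : ℕ) (θ : {p : Fin r × Fin m // ¬ constrained r m p} → ℝ) :
    Fin r × Fin m → ℝ :=
  fun p => if h : constrained r m p then 0 else θ ⟨p, h⟩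

/-- `ρ₀ = r^{5/2} (log n) / (Λ m^{r−1})^{1/2}`, with `n = r·m`. -/
noncomputable def rho0 (r m d : ℕ) : ℝ :=
  (r : ℝ) ^ ((5 : ℝ) / 2) * Real.log ((r : ℝ) * m) /
    Real.sqrt (Lam r m d * (m : ℝ) ^ (r - 1))

/-- `U_n(ρ) = {x ∈ ℝ^n : ‖x‖_∞ ≤ ρ}`. -/
def Uball (r m : ℕ) (ρ : ℝ) : Set (Fin r × Fin m → ℝ) := {θ | ∀ p, |θ p| ≤ ρ}

/-- `𝓑 = {θ ∈ U_n(π) : θ_{2m} = ⋯ = θ_{rm} = 0}`. -/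
def BSet (r m : ℕ) : Set (Fin r × Fin m → ℝ) :=
  {θ | (∀ p, |θ p| ≤ Real.pi) ∧ ∀ p, constrained r m p → θ p = 0}

/-- The circular distance `|x|_{2π} = min_{k∈ℤ} |x − 2πk|`. -/
noncomputable def circ (x : ℝ) : ℝ := ⨅ k : ℤ, |x - 2 * Real.pi * k|

/-- The main factor `m^{(r−1)/2} (2π/(Λ m^{r−1}))^{(n−r+1)/2}` in the estimates. -/
noncomputable def denseBound (r m d : ℕ) : ℝ :=
  (m : ℝ) ^ (((r : ℝ) - 1) / 2) *
    (2 * Real.pi / (Lam r m d * (m : ℝ) ^ (r - 1))) ^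
      ((((r * m : ℕ) : ℝ) - (r : ℝ) + 1) / 2)

/-- The region `𝓑₂` of `θ ∈ 𝓑` for which there is `(k₁,…,k_r) ∈ V₁×⋯×V_r` with
`|θ_{k₁}+⋯+θ_{k_r}|_{2π} ≥ ρ₀/3` and, for every `t`, at least `m − m/r` indices
`j ∈ V_t` with `|θ_j − θ_{k_t}|_{2π} ≤ ρ₀/(4r)`. -/
noncomputable def B2 (r m d : ℕ) : Set (Fin r × Fin m → ℝ) :=
  {θ | θ ∈ BSet r m ∧ ∃ k : Fin r → Fin m,
    rho0 r m d / 3 ≤ circ (∑ t : Fin r, θ (t, k t)) ∧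
    ∀ t : Fin r, (m : ℝ) - (m : ℝ) / (r : ℝ) ≤
      (Nat.card {j : Fin m //
        circ (θ (t, j) - θ (t, k t)) ≤ rho0 r m d / (4 * r)} : ℝ)}

theorem circ_le (x : ℝ) (k : ℤ) : circ x ≤ |x - 2 * Real.pi * k| :=
  ciInf_le ⟨0, by rintro _ ⟨k, rfl⟩; positivity⟩ k

theorem circ_add_le (x y : ℝ) : circ (x + y) ≤ circ x + circ y := by
  refine le_ciInf_add_ciInf fun k l => (circ_le (x + y) (k + l)).trans ?_
  refine le_trans (le_of_eq ?_) (abs_add_le _ _)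
  push_cast
  ring_nf

theorem circ_zero_le : circ 0 ≤ 0 := by simpa using circ_le 0 0

theorem circ_neg_le (x : ℝ) : circ (-x) ≤ circ x := by
  refine le_ciInf fun k => (circ_le (-x) (-k)).trans (le_of_eq ?_)
  rw [← abs_neg]
  push_cast
  ring_nf

theorem circ_sum_le {ι : Type*} (s : Finset ι) (f : ι → ℝ) :
    circ (∑ t ∈ s, f t) ≤ ∑ t ∈ s, circ (f t) := by
  classical
  induction s using Finset.induction_on with
  | empty => simpa using circ_zero_le
  | insert a s ha ih =>
    rw [Finset.sum_insert ha, Finset.sum_insert ha]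
    exact (circ_add_le _ _).trans (by gcongr)

theorem circ_sum_sub_le {ι : Type*} (s : Finset ι) (a b : ι → ℝ) :
    circ (∑ t ∈ s, b t) - ∑ t ∈ s, circ (a t - b t) ≤ circ (∑ t ∈ s, a t) := by
  have h1 : ∑ t ∈ s, b t = ∑ t ∈ s, a t + -∑ t ∈ s, (a t - b t) := by
    rw [Finset.sum_sub_distrib]; ring
  have h2 := circ_add_le (∑ t ∈ s, a t) (-∑ t ∈ s, (a t - b t))
  rw [← h1] at h2
  have h3 := circ_neg_le (∑ t ∈ s, (a t - b t))
  have h4 := circ_sum_le s (fun t => a t - b t)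
  linarith

theorem one_sub_cos_ge_of_le_circ {x δ : ℝ} (hδ : 0 ≤ δ) (h : δ ≤ circ x) :
    2 / Real.pi ^ 2 * δ ^ 2 ≤ 1 - Real.cos x := by
  obtain ⟨k, hk⟩ : ∃ k : ℤ, |x - 2 * Real.pi * k| ≤ Real.pi := by
    refine ⟨round (x / (2 * Real.pi)), ?_⟩
    have h1 := abs_sub_round (x / (2 * Real.pi))
    have hpi := Real.pi_pos
    have h2 : x - 2 * Real.pi * (round (x / (2 * Real.pi)) : ℤ)
        = 2 * Real.pi * (x / (2 * Real.pi) - (round (x / (2 * Real.pi)) : ℤ)) := by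
      field_simp
    rw [h2, abs_mul, abs_of_pos (by positivity)]
    nlinarith
  have h1 := Real.cos_le_one_sub_mul_cos_sq hk
  have h2 : Real.cos (x - 2 * Real.pi * k) = Real.cos x := by
    rw [mul_comm (2 * Real.pi)]
    exact Real.cos_sub_int_mul_two_pi x k
  have h3 : δ ^ 2 ≤ (x - 2 * Real.pi * k) ^ 2 := by
    rw [← sq_abs (x - 2 * Real.pi * k)]
    exact pow_le_pow_left₀ hδ (h.trans (circ_le x k)) 2
  have h4 : 2 / Real.pi ^ 2 * δ ^ 2 ≤ 2 / Real.pi ^ 2 * (x - 2 * Real.pi * k) ^ 2 := by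
    gcongr
  linarith

theorem norm_one_add_mul_exp_sub_one_le (l x : ℝ) :
    ‖(1 + (l : ℂ) * (Complex.exp (Complex.I * (x : ℂ)) - 1))‖ ≤
      Real.exp (-(l * (1 - l) * (1 - Real.cos x))) := by
  refine le_of_sq_le_sq ?_ (Real.exp_pos _).le
  have h : ‖(1 + (l : ℂ) * (Complex.exp (Complex.I * (x : ℂ)) - 1))‖ ^ 2
      = 1 - 2 * (l * (1 - l) * (1 - Real.cos x)) := by
    rw [Complex.sq_norm, mul_comm Complex.I, Complex.exp_mul_I, ← Complex.ofReal_cos,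
      ← Complex.ofReal_sin, Complex.normSq_apply]
    simp [-Complex.ofReal_cos, -Complex.ofReal_sin]
    linear_combination l ^ 2 * Real.sin_sq_add_cos_sq x
  rw [h, ← Real.exp_nat_mul]
  have := Real.add_one_le_exp (((2 : ℕ) : ℝ) * -(l * (1 - l) * (1 - Real.cos x)))
  refine le_trans (le_of_eq ?_) this
  push_cast
  ring

theorem one_sub_one_div_pow_ge {r : ℕ} (hr : 3 ≤ r) : (1 : ℝ) / 8 ≤ (1 - 1 / (r : ℝ)) ^ r := by
  have hr' : (3 : ℝ) ≤ r := by exact_mod_cast hr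
  have hx : (0 : ℝ) < 1 - 1 / (r : ℝ) := by
    rw [sub_pos, div_lt_one (by linarith)]; linarith
  have h1 : Real.exp (-(1 / ((r : ℝ) - 1))) ≤ 1 - 1 / (r : ℝ) := by
    rw [← Real.le_log_iff_exp_le hx]
    refine le_trans (le_of_eq ?_) (Real.one_sub_inv_le_log_of_pos hx)
    have : (r : ℝ) - 1 ≠ 0 := by linarith
    have : (r : ℝ) ≠ 0 := by linarith
    field_simp
    ring
  have h2 := pow_le_pow_left₀ (Real.exp_pos _).le h1 r
  refine le_trans ?_ h2
  rw [← Real.exp_nat_mul]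
  have h3 : (-2 : ℝ) ≤ (r : ℝ) * -(1 / ((r : ℝ) - 1)) := by
    have : (0 : ℝ) < (r : ℝ) - 1 := by linarith
    rw [mul_neg, neg_le_neg_iff, mul_one_div, div_le_iff₀ this]
    linarith
  refine le_trans ?_ (Real.exp_le_exp.mpr h3)
  rw [Real.exp_neg, one_div]
  gcongr
  have := Real.exp_one_lt_d9
  have h4 : Real.exp 2 = Real.exp 1 ^ 2 := by rw [← Real.exp_nat_mul]; norm_num
  rw [h4]
  nlinarith [Real.exp_pos 1]

theorem lam_mem_Ioo {r m d : ℕ} (hd : 1 ≤ d) (hdm : d ≤ m ^ (r - 1) - 1) :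
    lam r m d ∈ Set.Ioo (0 : ℝ) 1 := by
  have h : d < m ^ (r - 1) := by omega
  have h' : (d : ℝ) < (m : ℝ) ^ (r - 1) := by exact_mod_cast h
  have h1 : (1 : ℝ) ≤ d := by exact_mod_cast hd
  have h0 : (0 : ℝ) < (m : ℝ) ^ (r - 1) := by linarith
  exact ⟨div_pos (by linarith) h0, (div_lt_one h0).mpr h'⟩

theorem norm_Ffun_le_exp_sum (r m d : ℕ) (θ : Fin r × Fin m → ℝ) :
    ‖Ffun r m d θ‖ ≤
      Real.exp (-(Lam r m d * ∑ e : Fin r → Fin m, (1 - Real.cos (edgeSum r m θ e)))) := by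
  have h : ‖Complex.exp (-Complex.I * (d : ℂ) * ((∑ p : Fin r × Fin m, θ p : ℝ) : ℂ))‖ = 1 := by
    have h' : -Complex.I * (d : ℂ) * ((∑ p : Fin r × Fin m, θ p : ℝ) : ℂ)
        = ((-(d * ∑ p : Fin r × Fin m, θ p) : ℝ) : ℂ) * Complex.I := by
      push_cast; ring
    rw [h', Complex.norm_exp_ofReal_mul_I]
  rw [Ffun, norm_mul, h, mul_one, norm_prod, Finset.mul_sum, ← Finset.sum_neg_distrib,
    Real.exp_sum]
  exact Finset.prod_le_prod (fun _ _ => norm_nonneg _)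
    fun e _ => norm_one_add_mul_exp_sub_one_le _ _

theorem rho0_nonneg (r m d : ℕ) : 0 ≤ rho0 r m d := by
  refine div_nonneg (mul_nonneg (by positivity) ?_) (Real.sqrt_nonneg _)
  exact_mod_cast Real.log_natCast_nonneg (r * m)

theorem rho0_sq {r m d : ℕ} (h : 0 ≤ Lam r m d) :
    rho0 r m d ^ 2 =
      (r : ℝ) ^ 5 * Real.log ((r : ℝ) * m) ^ 2 / (Lam r m d * (m : ℝ) ^ (r - 1)) := by
  rw [rho0, div_pow, mul_pow, Real.sq_sqrt (by positivity), ← Real.rpow_natCast,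
    ← Real.rpow_mul (by positivity)]
  norm_num

theorem sum_one_sub_cos_ge_of_mem_B2 {r m d : ℕ} (hr : 3 ≤ r) {θ : Fin r × Fin m → ℝ}
    (hθ : θ ∈ B2 r m d) :
    (m : ℝ) ^ r / 8 * (2 / Real.pi ^ 2 * (rho0 r m d / 12) ^ 2) ≤
      ∑ e : Fin r → Fin m, (1 - Real.cos (edgeSum r m θ e)) := by
  classical
  obtain ⟨-, k, hk, hG⟩ := hθ
  have hr' : (3 : ℝ) ≤ r := by exact_mod_cast hr
  have hρ := rho0_nonneg r m d
  let G : Fin r → Finset (Fin m) := fun t =>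
    Finset.univ.filter fun j => circ (θ (t, j) - θ (t, k t)) ≤ rho0 r m d / (4 * r)
  have hcard : ∀ t, (m : ℝ) - (m : ℝ) / (r : ℝ) ≤ ((G t).card : ℝ) := by
    intro t
    have h := hG t
    rwa [Nat.card_eq_fintype_card, Fintype.card_subtype] at h
  have hsum : ∀ e ∈ Fintype.piFinset G,
      2 / Real.pi ^ 2 * (rho0 r m d / 12) ^ 2 ≤ 1 - Real.cos (edgeSum r m θ e) := by
    intro e he
    refine one_sub_cos_ge_of_le_circ (by positivity) ?_
    have h1 := circ_sum_sub_le Finset.univ (fun t => θ (t, e t)) (fun t => θ (t, k t))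
    have h2 : ∑ t : Fin r, circ (θ (t, e t) - θ (t, k t)) ≤ rho0 r m d / 4 := by
      calc _ ≤ ∑ t : Fin r, rho0 r m d / (4 * r) :=
            Finset.sum_le_sum fun t _ => (Finset.mem_filter.mp (Fintype.mem_piFinset.mp he t)).2
        _ = rho0 r m d / 4 := by
            rw [Finset.sum_const, Finset.card_univ, Fintype.card_fin, nsmul_eq_mul]
            field_simp
    rw [edgeSum]
    linarith
  have hN : (m : ℝ) ^ r / 8 ≤ ((Fintype.piFinset G).card : ℝ) := by
    rw [Fintype.card_piFinset, Nat.cast_prod]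
    have hnn : (0 : ℝ) ≤ (m : ℝ) - (m : ℝ) / (r : ℝ) := by
      rw [sub_nonneg]; exact div_le_self (by positivity) (by linarith)
    calc (m : ℝ) ^ r / 8 = (m : ℝ) ^ r * (1 / 8) := by ring
      _ ≤ (m : ℝ) ^ r * (1 - 1 / (r : ℝ)) ^ r := by gcongr; exact one_sub_one_div_pow_ge hr
      _ = ∏ t : Fin r, ((m : ℝ) - (m : ℝ) / (r : ℝ)) := by
          rw [Finset.prod_const, Finset.card_univ, Fintype.card_fin, ← mul_pow]; ring
      _ ≤ _ := Finset.prod_le_prod (fun _ _ => hnn) fun t _ => hcard t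
  calc _ ≤ ((Fintype.piFinset G).card : ℝ) * (2 / Real.pi ^ 2 * (rho0 r m d / 12) ^ 2) := by
        gcongr
    _ ≤ ∑ e ∈ Fintype.piFinset G, (1 - Real.cos (edgeSum r m θ e)) := by
        rw [← nsmul_eq_mul]; exact Finset.card_nsmul_le_sum _ _ _ hsum
    _ ≤ _ := Finset.sum_le_sum_of_subset_of_nonneg (Finset.subset_univ _)
        fun e _ _ => by linarith [Real.cos_le_one (edgeSum r m θ e)]

theorem norm_Ffun_le_of_mem_B2 {r m d : ℕ} (hr : 3 ≤ r) (hm : 1 ≤ m) (hΛ : 0 < Lam r m d)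
    {θ : Fin r × Fin m → ℝ} (hθ : θ ∈ B2 r m d) :
    ‖Ffun r m d θ‖ ≤
      Real.exp (-((r : ℝ) ^ 5 * m * Real.log ((r : ℝ) * m) ^ 2 / 9216)) := by
  refine (norm_Ffun_le_exp_sum r m d θ).trans (Real.exp_le_exp.mpr (neg_le_neg ?_))
  have h := mul_le_mul_of_nonneg_left (sum_one_sub_cos_ge_of_mem_B2 hr hθ) hΛ.le
  refine le_trans ?_ h
  have hm' : (0 : ℝ) < m := by exact_mod_cast hm
  have hpow : (m : ℝ) ^ r = (m : ℝ) ^ (r - 1) * m := by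
    rw [← pow_succ]; congr 1; omega
  have hpi : Real.pi ^ 2 ≤ 16 := by nlinarith [Real.pi_pos, Real.pi_le_four]
  have heq : Lam r m d * ((m : ℝ) ^ r / 8 * (2 / Real.pi ^ 2 * (rho0 r m d / 12) ^ 2))
      = (r : ℝ) ^ 5 * m * Real.log ((r : ℝ) * m) ^ 2 / (576 * Real.pi ^ 2) := by
    rw [div_pow, rho0_sq hΛ.le, hpow]
    have := Real.pi_pos
    field_simp
    ring
  rw [heq]
  gcongr
  linarith

theorem volume_real_preimage_B2_le {r m d : ℕ} :
    volume.real (ext r m ⁻¹' B2 r m d) ≤ Real.exp (2 * Real.pi * ((r * m : ℕ) : ℝ)) ∧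
      volume (ext r m ⁻¹' B2 r m d) < ⊤ := by
  have hsub : ext r m ⁻¹' B2 r m d ⊆ Set.Icc (fun _ => -Real.pi) (fun _ => Real.pi) := by
    rintro θ ⟨⟨hθ, -⟩, -⟩
    have h : ∀ p, |θ p| ≤ Real.pi := by
      intro p
      have := hθ p.1
      rwa [ext, dif_neg p.2] at this
    exact ⟨fun p => (abs_le.mp (h p)).1, fun p => (abs_le.mp (h p)).2⟩
  have hfin : volume (Set.Icc (fun _ : {p : Fin r × Fin m // ¬ constrained r m p} => -Real.pi)
      (fun _ => Real.pi)) < ⊤ := isCompact_Icc.measure_lt_top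
  refine ⟨(measureReal_mono hsub hfin.ne).trans ?_, (measure_mono hsub).trans_lt hfin⟩
  have hpi := Real.pi_gt_three
  have hcard : Fintype.card {p : Fin r × Fin m // ¬ constrained r m p} ≤ r * m := by
    refine (Fintype.card_subtype_le _).trans (le_of_eq ?_)
    simp
  rw [Measure.real, Real.volume_Icc_pi_toReal (fun _ => by linarith), Finset.prod_const,
    Finset.card_univ, mul_comm (2 * Real.pi), Real.exp_nat_mul]
  calc (Real.pi - -Real.pi) ^ Fintype.card {p : Fin r × Fin m // ¬ constrained r m p}
      ≤ (Real.pi - -Real.pi) ^ (r * m) := pow_le_pow_right₀ (by linarith) hcard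
    _ ≤ Real.exp (2 * Real.pi) ^ (r * m) :=
        pow_le_pow_left₀ (by linarith) (by linarith [Real.add_one_le_exp (2 * Real.pi)]) _

theorem exp_le_denseBound {r m d : ℕ} (hr : 1 ≤ r) (hm : 1 ≤ m) (hΛ : 0 < Lam r m d) :
    Real.exp (-((r : ℝ) * ((r * m : ℕ) : ℝ) * Real.log ((r : ℝ) * m))) ≤
      denseBound r m d := by
  have hr' : (1 : ℝ) ≤ r := by exact_mod_cast hr
  have hm' : (1 : ℝ) ≤ m := by exact_mod_cast hm
  have hΛ1 : Lam r m d ≤ 1 := by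
    rw [Lam]; nlinarith [sq_nonneg (lam r m d - 1 / 2)]
  have h1 : (1 : ℝ) ≤ (m : ℝ) ^ (((r : ℝ) - 1) / 2) := Real.one_le_rpow hm' (by linarith)
  set E : ℝ := (((r * m : ℕ) : ℝ) - (r : ℝ) + 1) / 2 with hE
  have hE0 : 0 ≤ E := by rw [hE]; push_cast; nlinarith
  have hE1 : E ≤ ((r * m : ℕ) : ℝ) := by rw [hE]; push_cast; nlinarith
  have hM : (0 : ℝ) < (m : ℝ) ^ (r - 1) := by positivity
  have hb : Real.exp (-((r : ℝ) * Real.log ((r : ℝ) * m))) ≤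
      2 * Real.pi / (Lam r m d * (m : ℝ) ^ (r - 1)) := by
    have hp : (m : ℝ) ^ (r - 1) ≤ ((r : ℝ) * m) ^ r :=
      calc (m : ℝ) ^ (r - 1) ≤ (m : ℝ) ^ r := pow_le_pow_right₀ hm' (by omega)
        _ ≤ ((r : ℝ) * m) ^ r := pow_le_pow_left₀ (by linarith) (by nlinarith) r
    rw [Real.exp_neg, Real.exp_nat_mul, Real.exp_log (by positivity), ← one_div]
    refine div_le_div₀ (by positivity) (by linarith [Real.pi_gt_three]) (by positivity) ?_
    nlinarith
  have h2 := Real.rpow_le_rpow (Real.exp_pos _).le hb hE0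
  rw [← Real.exp_mul] at h2
  have hL : 0 ≤ Real.log ((r : ℝ) * m) := Real.log_nonneg (by nlinarith)
  have h3 : Real.exp (-((r : ℝ) * ((r * m : ℕ) : ℝ) * Real.log ((r : ℝ) * m))) ≤
      Real.exp (-((r : ℝ) * Real.log ((r : ℝ) * m)) * E) := by
    refine Real.exp_le_exp.mpr ?_
    have := mul_le_mul_of_nonneg_left hE1 (mul_nonneg (by linarith : (0 : ℝ) ≤ r) hL)
    linarith
  rw [denseBound]
  exact (h3.trans h2).trans (le_mul_of_one_le_left (by positivity) h1)

/-- for all `c, K > 0` there is `N` such that whenever `n = rm ≥ N`,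
`r ≥ 3`, `1 ≤ d ≤ m^{r−1} − 1` and `Λ ≥ c·r^16·m^{2−r}`,
`∫_{𝓑₂} |F| ≤ e^{−K r n log n} · m^{(r−1)/2} (2π/(Λ m^{r−1}))^{(n−r+1)/2}`. -/
theorem abs_integral_B2_bound (c K : ℝ) (hc : 0 < c) (hK : 0 < K) :
    ∃ N : ℕ, ∀ r m d : ℕ, 3 ≤ r → 1 ≤ m → N ≤ r * m →
      1 ≤ d → d ≤ m ^ (r - 1) - 1 →
      c * (r : ℝ) ^ 16 * (m : ℝ) ^ ((2 : ℤ) - (r : ℤ)) ≤ Lam r m d →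
      (∫ θ in ext r m ⁻¹' B2 r m d, ‖Ffun r m d (ext r m θ)‖) ≤
        Real.exp (-(K * (r : ℝ) * ((r * m : ℕ) : ℝ) * Real.log ((r : ℝ) * m))) *
          denseBound r m d := by
  let T : ℝ := 9216 * (9 + K)
  refine ⟨⌈Real.exp T⌉₊, ?_⟩
  intro r m d hr hm hN hd hdm _
  have hr' : (3 : ℝ) ≤ r := by exact_mod_cast hr
  have hm' : (1 : ℝ) ≤ m := by exact_mod_cast hm
  obtain ⟨hl0, hl1⟩ := lam_mem_Ioo hd hdm
  have hΛ : 0 < Lam r m d := mul_pos hl0 (by linarith)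
  have hn : Real.exp T ≤ (r : ℝ) * m := by
    exact_mod_cast (Nat.le_ceil _).trans (Nat.cast_le.mpr hN)
  have hL : T ≤ Real.log ((r : ℝ) * m) := by
    rwa [Real.le_log_iff_exp_le (by positivity)]
  obtain ⟨hvol, hfin⟩ := volume_real_preimage_B2_le (r := r) (m := m) (d := d)
  have hint := norm_setIntegral_le_of_norm_le_const (μ := volume) hfin
    (f := fun θ => ‖Ffun r m d (ext r m θ)‖)
    (fun θ hθ => (norm_norm _).le.trans (norm_Ffun_le_of_mem_B2 hr hm hΛ hθ))
  refine (le_abs_self _).trans (hint.trans ?_)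
  calc _ ≤ Real.exp (-((r : ℝ) ^ 5 * m * Real.log ((r : ℝ) * m) ^ 2 / 9216)) *
        Real.exp (2 * Real.pi * ((r * m : ℕ) : ℝ)) := by gcongr
    _ ≤ Real.exp (-(K * (r : ℝ) * ((r * m : ℕ) : ℝ) * Real.log ((r : ℝ) * m))) *
        Real.exp (-((r : ℝ) * ((r * m : ℕ) : ℝ) * Real.log ((r : ℝ) * m))) := by
      rw [← Real.exp_add, ← Real.exp_add, Real.exp_le_exp]
      push_cast
      set L := Real.log ((r : ℝ) * m)
      have hL1 : 1 ≤ L := le_trans (by simp only [T]; linarith) hL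
      have hKL : 9 + K ≤ L / 9216 := by simp only [T] at hL; linarith
      have hr3 : (r : ℝ) ^ 2 ≤ (r : ℝ) ^ 5 := pow_le_pow_right₀ (by linarith) (by norm_num)
      have e1 : 2 * Real.pi * (r * m) ≤ 8 * (r * (r * m) * L) := by
        have : (r : ℝ) * m ≤ r * (r * m) * L := by
          have : 1 ≤ r * L := by nlinarith
          nlinarith [mul_le_mul_of_nonneg_left this (by positivity : (0 : ℝ) ≤ r * m)]
        have := Real.pi_le_four
        nlinarith [Real.pi_pos, (by positivity : (0 : ℝ) ≤ r * m)]
      have e2 : (9 + K) * (r * (r * m) * L) ≤ r ^ 5 * m * L ^ 2 / 9216 :=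
        calc (9 + K) * (r * (r * m) * L) ≤ L / 9216 * (r * (r * m) * L) := by gcongr
          _ = r ^ 2 * (m * L ^ 2 / 9216) := by ring
          _ ≤ r ^ 5 * (m * L ^ 2 / 9216) := by gcongr
          _ = _ := by ring
      linarith
    _ ≤ _ := by
      gcongr
      exact exp_le_denseBound (by omega) hm hΛ
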